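/- arXiv:1512.03292 — 6 statements merged into one kernel-verified Lean document; each statement's English description precedes it below -/
import Mathlib

section
/- Let E be a nonempty closed subset of ℝ^d containing an affine basis, and let (P_{s,t}) be a transition function on E that is real-affine with functions Φ (real-valued) and ψ (ℝ^d-valued). Then for all 0 ≤ s ≤ t ≤ T and every u ∈ 𝒰_ℝ: Φ_{t,T}(u) > 0, ψ_{t,T}(u) ∈ 𝒰_ℝ, and the semiflow equations hold: Φ_{s,T}(u) = Φ_{s,t}(ψ_{t,T}(u)) · Φ_{t,T}(u) and ψ_{s,T}(u) = ψ_{s,t}(ψ_{t,T}(u)). Moreover Φ_{t,t}(u) = 1 and ψ_{t,t}(u) = u for all t ≥ 0 and u ∈ 𝒰_ℝ. -/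
open MeasureTheory

/-- A vector orthogonal to a linearly independent family of `d` vectors in `ℝ^d` vanishes. -/
theorem eq_zero_of_forall_sum_mul_eq_zero {d : ℕ} {v : Fin d → Fin d → ℝ}
    (hv : LinearIndependent ℝ v) {w : Fin d → ℝ} (h : ∀ i, ∑ j, w j * v i j = 0) : w = 0 := by
  refine Matrix.eq_zero_of_mulVec_eq_zero (M := Matrix.of v) ?_ ?_
  · exact ((Matrix.isUnit_iff_isUnit_det _).mp
      (Matrix.linearIndependent_rows_iff_isUnit.mp hv)).ne_zero
  · ext i
    simpa [Matrix.mulVec, dotProduct, mul_comm] using h i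

/-- The prefactor and the exponent of an exponential-affine function are determined by its values
on an affine basis. -/
theorem exp_affine_unique {d : ℕ} {basis : Fin (d + 1) → Fin d → ℝ}
    (hbasis : LinearIndependent ℝ (fun i : Fin d => basis i.succ - basis 0))
    {a b : ℝ} {p q : Fin d → ℝ} (ha : 0 < a) (hb : 0 < b)
    (h : ∀ i, a * Real.exp (∑ j, p j * basis i j) = b * Real.exp (∑ j, q j * basis i j)) :
    a = b ∧ p = q := by
  have hlog (i) : Real.log a + ∑ j, p j * basis i j = Real.log b + ∑ j, q j * basis i j := by
    have := congrArg Real.log (h i)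
    rwa [Real.log_mul ha.ne' (Real.exp_ne_zero _), Real.log_mul hb.ne' (Real.exp_ne_zero _),
      Real.log_exp, Real.log_exp] at this
  have hpq : p = q := by
    rw [← sub_eq_zero]
    refine eq_zero_of_forall_sum_mul_eq_zero hbasis fun i => ?_
    simp only [Pi.sub_apply, sub_mul, mul_sub, Finset.sum_sub_distrib]
    linarith [hlog i.succ, hlog 0]
  subst hpq
  exact ⟨mul_right_cancel₀ (Real.exp_ne_zero _) (h 0), rfl⟩

/-- For a real-affine transition function on a nonempty closed set `E ⊆ ℝ^d` containing an
affine basis: `Φ_{t,T}(u) > 0`, `ψ_{t,T}(u) ∈ 𝒰_ℝ`, the semiflow equations hold, and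
`Φ_{t,t}(u) = 1`, `ψ_{t,t}(u) = u`. -/
theorem stmt_5 (d : ℕ) (E : Set (Fin d → ℝ)) (hEne : E.Nonempty) (hEcl : IsClosed E)
    (basis : Fin (d + 1) → (Fin d → ℝ))
    (hbasisE : ∀ i, basis i ∈ E)
    (hbasisLI : LinearIndependent ℝ (fun i : Fin d => basis i.succ - basis 0))
    (P : ℝ → ℝ → E → Measure E)
    (hprob : ∀ s t (x : E), IsProbabilityMeasure (P s t x))
    (hker : ∀ s t, Measurable (P s t))
    (hCK : ∀ s r t, 0 ≤ s → s ≤ r → r ≤ t → ∀ (x : E) (A : Set E), MeasurableSet A →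
      P s t x A = ∫⁻ y, P r t y A ∂(P s r x))
    (hdirac : ∀ s, 0 ≤ s → ∀ x : E, P s s x = Measure.dirac x)
    (U : Set (Fin d → ℝ))
    (hUdef : U = {u : Fin d → ℝ | ∃ K : ℝ, ∀ x ∈ E, Real.exp (∑ j, u j * x j) ≤ K})
    (Φ : ℝ → ℝ → (Fin d → ℝ) → ℝ) (ψ : ℝ → ℝ → (Fin d → ℝ) → (Fin d → ℝ))
    (haff : ∀ s t, 0 ≤ s → s ≤ t → ∀ u ∈ U, ∀ x : E,
      (∫ ξ : E, Real.exp (∑ j, u j * (ξ : Fin d → ℝ) j) ∂(P s t x))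
        = Φ s t u * Real.exp (∑ j, ψ s t u j * (x : Fin d → ℝ) j)) :
    (∀ s t T, 0 ≤ s → s ≤ t → t ≤ T → ∀ u ∈ U,
      0 < Φ t T u ∧ ψ t T u ∈ U ∧
      Φ s T u = Φ s t (ψ t T u) * Φ t T u ∧
      ψ s T u = ψ s t (ψ t T u)) ∧
    (∀ t, 0 ≤ t → ∀ u ∈ U, Φ t t u = 1 ∧ ψ t t u = u) := by
  have hmem (u : Fin d → ℝ) : u ∈ U ↔ ∃ K : ℝ, ∀ x ∈ E, Real.exp (∑ j, u j * x j) ≤ K := by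
    rw [hUdef]; rfl
  have hint (u : Fin d → ℝ) (hu : u ∈ U) (s t : ℝ) (x : E) :
      Integrable (fun ξ : E => Real.exp (∑ j, u j * (ξ : Fin d → ℝ) j)) (P s t x) := by
    obtain ⟨K, hK⟩ := (hmem u).1 hu
    have hcont : Continuous fun ξ : E => Real.exp (∑ j, u j * (ξ : Fin d → ℝ) j) :=
      Real.continuous_exp.comp (continuous_finsetSum _ fun j _ =>
        continuous_const.mul ((continuous_apply j).comp continuous_subtype_val))
    refine Integrable.of_bound (C := K) hcont.aestronglyMeasurable
      (.of_forall fun ξ => ?_)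
    rw [Real.norm_of_nonneg (Real.exp_pos _).le]
    exact hK _ ξ.2
  have hpos (s t : ℝ) (hs : 0 ≤ s) (hst : s ≤ t) (u : Fin d → ℝ) (hu : u ∈ U) : 0 < Φ s t u := by
    have h := integral_exp_pos (hint u hu s t ⟨basis 0, hbasisE 0⟩)
    rw [haff s t hs hst u hu] at h
    exact pos_of_mul_pos_left h (Real.exp_pos _).le
  have hψ (s t : ℝ) (hs : 0 ≤ s) (hst : s ≤ t) (u : Fin d → ℝ) (hu : u ∈ U) : ψ s t u ∈ U := by
    obtain ⟨K, hK⟩ := (hmem u).1 hu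
    refine (hmem _).2 ⟨K / Φ s t u, fun x hx => ?_⟩
    rw [le_div_iff₀' (hpos s t hs hst u hu), ← haff s t hs hst u hu ⟨x, hx⟩]
    calc _ ≤ ∫ _ξ : E, K ∂(P s t ⟨x, hx⟩) :=
          integral_mono (hint u hu s t _) (integrable_const K) fun ξ => hK _ ξ.2
      _ = K := by simp
  refine ⟨fun s t T hs hst htT u hu => ?_, fun t ht u hu => ?_⟩
  · have ht := hs.trans hst
    have hΦt := hpos t T ht htT u hu
    have hψt := hψ t T ht htT u hu
    refine ⟨hΦt, hψt, exp_affine_unique hbasisLI (hpos s T hs (hst.trans htT) u hu)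
      (mul_pos (hpos s t hs hst _ hψt) hΦt) fun i => ?_⟩
    set x : E := ⟨basis i, hbasisE i⟩
    let κ : ProbabilityTheory.Kernel E E := ⟨P s t, hker s t⟩
    let η : ProbabilityTheory.Kernel E E := ⟨P t T, hker t T⟩
    have hcomp : P s T x = (η.comp κ) x := by
      ext A hA
      rw [hCK s t T hs hst htT x A hA, ProbabilityTheory.Kernel.comp_apply' _ _ _ hA]
      rfl
    have hu' := hint u hu s T x
    have hfub := haff s T hs (hst.trans htT) u hu x
    rw [hcomp] at hu' hfub
    have : ProbabilityTheory.IsMarkovKernel κ := ⟨hprob s t⟩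
    have : ProbabilityTheory.IsMarkovKernel η := ⟨hprob t T⟩
    rw [ProbabilityTheory.Kernel.integral_comp hu'] at hfub
    change ∫ y, ∫ ξ : E, Real.exp (∑ j, u j * (ξ : Fin d → ℝ) j) ∂(P t T y) ∂(P s t x) = _ at hfub
    simp only [haff t T ht htT u hu] at hfub
    rw [integral_const_mul, haff s t hs hst _ hψt] at hfub
    rw [← hfub]
    ring
  · refine exp_affine_unique hbasisLI (hpos t t ht le_rfl u hu) one_pos fun i => ?_
    rw [← haff t t ht le_rfl u hu ⟨basis i, hbasisE i⟩, hdirac t ht, integral_dirac, one_mul]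
end

section
/- Let n ≥ 1 and let A_1,…,A_n, B_0,…,B_n, a_1,…,a_n, b_0,…,b_n and c_1,…,c_n be real numbers with c_i > 0, b_i ≥ 0 and |a_i| < b_0 − b_i for every i = 1,…,n. Define g : ℝ → ℝ by g(x) = Σ_{i=1}^n c_i e^{A_i + a_i x} cosh(B_i + b_i x) / cosh(B_0 + b_0 x). Then there exists a unique ξ ∈ ℝ at which g attains its global maximum; g is strictly increasing on (−∞, ξ] and strictly decreasing on [ξ, ∞), and g(x) → 0 as x → +∞ and as x → −∞. -/
open Filter

theorem tendsto_exp_div_cosh_atTop {l β : ℝ} (h : l < β) (B : ℝ) :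
    Tendsto (fun x => Real.exp (l * x) / Real.cosh (B + β * x)) atTop (nhds 0) := by
  have hlim : Tendsto (fun x => 2 * Real.exp (-B) * Real.exp ((l - β) * x)) atTop (nhds 0) := by
    have h1 : Tendsto (fun x : ℝ => (l - β) * x) atTop atBot :=
      tendsto_id.const_mul_atTop_of_neg (by linarith)
    simpa using (Real.tendsto_exp_atBot.comp h1).const_mul (2 * Real.exp (-B))
  refine squeeze_zero (fun x => by positivity) (fun x => ?_) hlim
  rw [div_le_iff₀ (Real.cosh_pos _)]
  calc Real.exp (l * x)
      = 2 * Real.exp (-B) * Real.exp ((l - β) * x) * (Real.exp (B + β * x) / 2) := by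
        rw [show 2 * Real.exp (-B) * Real.exp ((l - β) * x) * (Real.exp (B + β * x) / 2)
          = Real.exp (-B) * Real.exp ((l - β) * x) * Real.exp (B + β * x) by ring,
          ← Real.exp_add, ← Real.exp_add]
        ring_nf
    _ ≤ _ := by
        gcongr
        rw [Real.cosh_eq]
        linarith [Real.exp_pos (-(B + β * x))]

theorem tendsto_exp_div_cosh_atBot {l β : ℝ} (h : -β < l) (B : ℝ) :
    Tendsto (fun x => Real.exp (l * x) / Real.cosh (B + β * x)) atBot (nhds 0) := by
  refine ((tendsto_exp_div_cosh_atTop (neg_lt.mp h) (-B)).comp tendsto_neg_atBot_atTop).congr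
    fun x => ?_
  rw [Function.comp_apply, neg_mul_neg, ← Real.cosh_neg (B + β * x)]
  ring_nf

theorem exists_isMax_of_hasDerivAt_strictAnti_div {g N D : ℝ → ℝ}
    (hg : ∀ x, HasDerivAt g (N x / D x) x) (hN : StrictAnti N) (hD : ∀ x, 0 < D x)
    (hpos : ∀ x, 0 < g x) (htop : Tendsto g atTop (nhds 0)) (hbot : Tendsto g atBot (nhds 0)) :
    ∃ ξ : ℝ, (∀ x, g x ≤ g ξ) ∧ (∀ ξ' : ℝ, (∀ x, g x ≤ g ξ') → ξ' = ξ) ∧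
      StrictMonoOn g (Set.Iic ξ) ∧ StrictAntiOn g (Set.Ici ξ) := by
  have hcont : Continuous g := continuous_iff_continuousAt.2 fun x => (hg x).continuousAt
  obtain ⟨ξ, hξ⟩ : ∃ ξ, ∀ x, g x ≤ g ξ := by
    refine hcont.exists_forall_ge' 0 ?_
    rw [cocompact_eq_atBot_atTop, eventually_sup]
    exact ⟨(hbot.eventually_lt_const (hpos 0)).mono fun _ h => h.le,
      (htop.eventually_lt_const (hpos 0)).mono fun _ h => h.le⟩
  have hzero : N ξ = 0 := by
    have h := IsLocalMax.hasDerivAt_eq_zero (Eventually.of_forall hξ) (hg ξ)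
    exact (div_eq_zero_iff.1 h).resolve_right (hD ξ).ne'
  have hmono : StrictMonoOn g (Set.Iic ξ) := by
    refine strictMonoOn_of_deriv_pos (convex_Iic ξ) hcont.continuousOn fun x hx => ?_
    rw [interior_Iic] at hx
    rw [(hg x).deriv]
    exact div_pos (hzero ▸ hN hx) (hD x)
  have hanti : StrictAntiOn g (Set.Ici ξ) := by
    refine strictAntiOn_of_deriv_neg (convex_Ici ξ) hcont.continuousOn fun x hx => ?_
    rw [interior_Ici] at hx
    rw [(hg x).deriv]
    exact div_neg_of_neg_of_pos (hzero ▸ hN hx) (hD x)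
  refine ⟨ξ, hξ, fun ξ' h => ?_, hmono, hanti⟩
  rcases lt_trichotomy ξ' ξ with hlt | heq | hlt
  · exact absurd (h ξ) (hmono hlt.le Set.self_mem_Iic hlt).not_ge
  · exact heq
  · exact absurd (h ξ) (hanti Set.self_mem_Ici hlt.le hlt).not_ge

theorem hasDerivAt_cosh_affine (B β x : ℝ) :
    HasDerivAt (fun x => Real.cosh (B + β * x)) (β * Real.sinh (B + β * x)) x := by
  simpa [mul_comm] using (((hasDerivAt_id x).const_mul β).const_add B).cosh

theorem hasDerivAt_sinh_affine (B β x : ℝ) :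
    HasDerivAt (fun x => Real.sinh (B + β * x)) (β * Real.cosh (B + β * x)) x := by
  simpa [mul_comm] using (((hasDerivAt_id x).const_mul β).const_add B).sinh

theorem hasDerivAt_exp_mul (l x : ℝ) :
    HasDerivAt (fun x => Real.exp (l * x)) (l * Real.exp (l * x)) x := by
  simpa [mul_comm] using ((hasDerivAt_id x).const_mul l).exp

theorem strictAnti_exp_mul_sub {l β : ℝ} (h : |l| < β) (B : ℝ) :
    StrictAnti fun x => Real.exp (l * x) *
      (l * Real.cosh (B + β * x) - β * Real.sinh (B + β * x)) := by
  refine strictAnti_of_hasDerivAt_neg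
    (f' := fun x => (l ^ 2 - β ^ 2) * (Real.exp (l * x) * Real.cosh (B + β * x)))
    (fun x => ?_) fun x => ?_
  · refine ((hasDerivAt_exp_mul l x).fun_mul
      (((hasDerivAt_cosh_affine B β x).const_mul l).fun_sub
        ((hasDerivAt_sinh_affine B β x).const_mul β))).congr_deriv ?_
    ring
  · have : l ^ 2 < β ^ 2 := sq_lt_sq.2 (h.trans_le (le_abs_self β))
    exact mul_neg_of_neg_of_pos (by linarith) (by positivity)

/-- A positive combination of exponentials with rates in `(-β, β)`, divided by
`cosh (B + β x)`, is strictly unimodal and vanishes at `±∞`. -/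
theorem exists_isMax_sum_exp_div_cosh {ι : Type*} [Fintype ι] [Nonempty ι] {C l : ι → ℝ} {β : ℝ}
    (hC : ∀ j, 0 < C j) (hl : ∀ j, |l j| < β) (B : ℝ) {g : ℝ → ℝ}
    (hg : ∀ x, g x = ∑ j, C j * (Real.exp (l j * x) / Real.cosh (B + β * x))) :
    ∃ ξ : ℝ,
      (∀ x, g x ≤ g ξ) ∧
      (∀ ξ' : ℝ, (∀ x, g x ≤ g ξ') → ξ' = ξ) ∧
      StrictMonoOn g (Set.Iic ξ) ∧
      StrictAntiOn g (Set.Ici ξ) ∧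
      Tendsto g atTop (nhds 0) ∧
      Tendsto g atBot (nhds 0) := by
  obtain rfl : g = _ := funext hg
  have htop : Tendsto (fun x => ∑ j, C j * (Real.exp (l j * x) / Real.cosh (B + β * x)))
      atTop (nhds 0) := by
    simpa using tendsto_finsetSum Finset.univ fun j _ =>
      (tendsto_exp_div_cosh_atTop (abs_lt.1 (hl j)).2 B).const_mul (C j)
  have hbot : Tendsto (fun x => ∑ j, C j * (Real.exp (l j * x) / Real.cosh (B + β * x)))
      atBot (nhds 0) := by
    simpa using tendsto_finsetSum Finset.univ fun j _ =>
      (tendsto_exp_div_cosh_atBot (abs_lt.1 (hl j)).1 B).const_mul (C j)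
  obtain ⟨ξ, h₁, h₂, h₃, h₄⟩ := exists_isMax_of_hasDerivAt_strictAnti_div
    (g := fun x => ∑ j, C j * (Real.exp (l j * x) / Real.cosh (B + β * x)))
    (N := fun x => ∑ j, C j * (Real.exp (l j * x) *
      (l j * Real.cosh (B + β * x) - β * Real.sinh (B + β * x))))
    (D := fun x => Real.cosh (B + β * x) ^ 2)
    (fun x => by
      rw [Finset.sum_div]
      refine HasDerivAt.fun_sum fun j _ => ?_
      refine (((hasDerivAt_exp_mul (l j) x).fun_div (hasDerivAt_cosh_affine B β x)
        (Real.cosh_pos _).ne').const_mul (C j)).congr_deriv ?_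
      ring)
    (fun x y hxy => Finset.sum_lt_sum_of_nonempty Finset.univ_nonempty fun j _ =>
      mul_lt_mul_of_pos_left (strictAnti_exp_mul_sub (hl j) B hxy) (hC j))
    (fun x => by positivity)
    (fun x => Finset.sum_pos (fun j _ => mul_pos (hC j) (by positivity)) Finset.univ_nonempty)
    htop hbot
  exact ⟨ξ, h₁, h₂, h₃, h₄, htop, hbot⟩

/-- The function `g(x) = Σ c_i e^{A_i + a_i x} cosh(B_i + b_i x)/cosh(B_0 + b_0 x)` with
`c_i > 0`, `b_i ≥ 0`, `|a_i| < b_0 − b_i` has a unique global maximum point `ξ`, is strictly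
increasing on `(−∞,ξ]`, strictly decreasing on `[ξ,∞)`, and tends to `0` at `±∞`. -/
theorem stmt_9 (n : ℕ) (hn : 1 ≤ n)
    (A a B b c : Fin n → ℝ) (B₀ b₀ : ℝ)
    (hc : ∀ i, 0 < c i) (hb : ∀ i, 0 ≤ b i) (ha : ∀ i, |a i| < b₀ - b i)
    (g : ℝ → ℝ)
    (hg : ∀ x, g x = ∑ i, c i * Real.exp (A i + a i * x) * Real.cosh (B i + b i * x)
        / Real.cosh (B₀ + b₀ * x)) :
    ∃ ξ : ℝ,
      (∀ x, g x ≤ g ξ) ∧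
      (∀ ξ' : ℝ, (∀ x, g x ≤ g ξ') → ξ' = ξ) ∧
      StrictMonoOn g (Set.Iic ξ) ∧
      StrictAntiOn g (Set.Ici ξ) ∧
      Tendsto g atTop (nhds 0) ∧
      Tendsto g atBot (nhds 0) := by
  have : Nonempty (Fin n) := ⟨⟨0, hn⟩⟩
  refine exists_isMax_sum_exp_div_cosh (ι := Fin n ⊕ Fin n)
    (C := Sum.elim (fun i => c i * Real.exp (A i + B i) / 2)
      fun i => c i * Real.exp (A i - B i) / 2)
    (l := Sum.elim (fun i => a i + b i) fun i => a i - b i) (β := b₀) ?_ ?_ B₀ fun x => ?_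
  · rintro (i | i) <;> have := hc i <;> simp only [Sum.elim_inl, Sum.elim_inr] <;> positivity
  · rintro (i | i) <;> have := hb i <;> have := abs_lt.1 (ha i) <;>
      simp only [Sum.elim_inl, Sum.elim_inr] <;> rw [abs_lt] <;> constructor <;> linarith
  · rw [hg, Fintype.sum_sum_type, ← Finset.sum_add_distrib]
    refine Finset.sum_congr rfl fun i _ => ?_
    simp only [Sum.elim_inl, Sum.elim_inr]
    rw [Real.cosh_eq (B i + b i * x), sub_eq_add_neg (A i), sub_eq_add_neg (a i), neg_add,
      ← neg_mul]
    simp only [add_mul, Real.exp_add]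
    ring
end

section
/- Let a, b, b_0, B, B_0 be real numbers with b ≥ 0 and |a| < b_0 − b. Define f : ℝ → ℝ by f(x) = a cosh(B + bx) cosh(B_0 + b_0 x) + b sinh(B + bx) cosh(B_0 + b_0 x) − b_0 cosh(B + bx) sinh(B_0 + b_0 x). Then f is strictly decreasing on ℝ (f′(x) < 0 for all x), f(x) → +∞ as x → −∞, and f(x) → −∞ as x → +∞. -/
open Filter

/-- A function whose derivative is bounded above by a negative constant tends to `-∞` at `+∞`. -/
theorem tendsto_atTop_atBot_of_deriv_le {f : ℝ → ℝ} {k : ℝ} (hk : k < 0)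
    (hf : Differentiable ℝ f) (hf' : ∀ x, deriv f x ≤ k) : Tendsto f atTop atBot := by
  have hlin : Tendsto (fun x : ℝ => f 0 + k * x) atTop atBot :=
    tendsto_atBot_add_const_left _ _ (tendsto_id.const_mul_atTop_of_neg hk)
  refine tendsto_atBot_mono' _ ?_ hlin
  filter_upwards [eventually_ge_atTop 0] with x hx
  linarith [image_sub_le_mul_sub_of_deriv_le hf hf' hx]

/-- A function whose derivative is bounded above by a negative constant tends to `+∞` at `-∞`. -/
theorem tendsto_atBot_atTop_of_deriv_le {f : ℝ → ℝ} {k : ℝ} (hk : k < 0)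
    (hf : Differentiable ℝ f) (hf' : ∀ x, deriv f x ≤ k) : Tendsto f atBot atTop := by
  have hlin : Tendsto (fun x : ℝ => f 0 + k * x) atBot atTop :=
    tendsto_atTop_add_const_left _ _ (tendsto_id.const_mul_atBot_of_neg hk)
  refine tendsto_atTop_mono' _ ?_ hlin
  filter_upwards [eventually_le_atBot 0] with x hx
  linarith [image_sub_le_mul_sub_of_deriv_le hf hf' hx]

theorem Real.abs_sinh_le_cosh (x : ℝ) : |Real.sinh x| ≤ Real.cosh x :=
  abs_le_of_sq_le_sq (by linarith [Real.cosh_sq x]) (Real.cosh_pos x).le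

/-- With `b ≥ 0` and `|a| < b₀ − b`, the function
`f(x) = a cosh(B+bx)cosh(B₀+b₀x) + b sinh(B+bx)cosh(B₀+b₀x) − b₀ cosh(B+bx)sinh(B₀+b₀x)`
is strictly decreasing with everywhere negative derivative, tends to `+∞` at `−∞` and to
`−∞` at `+∞`. -/
theorem stmt_10 (a b b₀ B B₀ : ℝ) (hb : 0 ≤ b) (ha : |a| < b₀ - b)
    (f : ℝ → ℝ)
    (hf : ∀ x, f x = a * Real.cosh (B + b * x) * Real.cosh (B₀ + b₀ * x)
        + b * Real.sinh (B + b * x) * Real.cosh (B₀ + b₀ * x)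
        - b₀ * Real.cosh (B + b * x) * Real.sinh (B₀ + b₀ * x)) :
    StrictAnti f ∧ (∀ x, deriv f x < 0) ∧
      Tendsto f atBot atTop ∧ Tendsto f atTop atBot := by
  have hderiv (x : ℝ) : HasDerivAt f
      (a * (b * Real.sinh (B + b * x) * Real.cosh (B₀ + b₀ * x)
          + b₀ * Real.cosh (B + b * x) * Real.sinh (B₀ + b₀ * x))
        - (b₀ - b) * (b₀ + b) * (Real.cosh (B + b * x) * Real.cosh (B₀ + b₀ * x))) x := by
    have haff (c d : ℝ) : HasDerivAt (fun y : ℝ => c + d * y) d x := by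
      simpa using ((hasDerivAt_id x).const_mul d).const_add c
    have hC := (haff B b).cosh
    have hS := (haff B b).sinh
    have hC₀ := (haff B₀ b₀).cosh
    have hS₀ := (haff B₀ b₀).sinh
    rw [funext hf]
    refine ((((hC.const_mul a).mul hC₀).add ((hS.const_mul b).mul hC₀)).sub
      ((hC.const_mul b₀).mul hS₀)).congr_deriv ?_
    ring
  have hgap : 0 < b₀ - b - |a| := by linarith
  have hsum : 0 < b₀ + b := by linarith [abs_nonneg a]
  have hb₀ : 0 ≤ b₀ := by linarith [abs_nonneg a]
  have hk : -((b₀ - b - |a|) * (b₀ + b)) < 0 := neg_neg_of_pos (mul_pos hgap hsum)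
  have hle (x : ℝ) : deriv f x ≤ -((b₀ - b - |a|) * (b₀ + b)) := by
    rw [(hderiv x).deriv]
    set u := B + b * x
    set v := B₀ + b₀ * x
    have hcosh : 1 ≤ Real.cosh u * Real.cosh v :=
      one_le_mul_of_one_le_of_one_le (Real.one_le_cosh u) (Real.one_le_cosh v)
    have hbound : |b * Real.sinh u * Real.cosh v + b₀ * Real.cosh u * Real.sinh v|
        ≤ (b₀ + b) * (Real.cosh u * Real.cosh v) := by
      calc _ ≤ b * |Real.sinh u| * Real.cosh v + b₀ * Real.cosh u * |Real.sinh v| := by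
            refine (abs_add_le _ _).trans_eq ?_
            simp only [abs_mul, abs_of_nonneg hb, abs_of_nonneg hb₀, abs_of_pos (Real.cosh_pos _)]
        _ ≤ b * Real.cosh u * Real.cosh v + b₀ * Real.cosh u * Real.cosh v := by
            have := (Real.cosh_pos u).le
            have := (Real.cosh_pos v).le
            gcongr <;> exact Real.abs_sinh_le_cosh _
        _ = _ := by ring
    have hmul : a * (b * Real.sinh u * Real.cosh v + b₀ * Real.cosh u * Real.sinh v)
        ≤ |a| * ((b₀ + b) * (Real.cosh u * Real.cosh v)) := by
      refine (le_abs_self _).trans ?_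
      rw [abs_mul]
      gcongr
    linarith [mul_le_mul_of_nonneg_left hcosh (mul_pos hgap hsum).le]
  have hdiff : Differentiable ℝ f := fun x => (hderiv x).differentiableAt
  have hneg (x : ℝ) : deriv f x < 0 := (hle x).trans_lt hk
  exact ⟨strictAnti_of_deriv_neg hneg, hneg, tendsto_atBot_atTop_of_deriv_le hk hdiff hle,
    tendsto_atTop_atBot_of_deriv_le hk hdiff hle⟩
end

section
/- Let (Ω, 𝒜, μ) be a probability space and X : Ω → ℝ a random variable. Let f(x) = (Σ_{k=1}^n C_k e^{v_k x}) · 1_{(κ_1,κ_2)}(x) with real constants C_k, v_k and κ_1 < κ_2, satisfying Σ_{k=1}^n C_k e^{v_k κ_1} = 0 and Σ_{k=1}^n C_k e^{v_k κ_2} = 0, and let f̂(z) = (1/(iz)) Σ_{k=1}^n C_k v_k/(v_k − iz)(e^{(v_k−iz)κ_2} − e^{(v_k−iz)κ_1}). Let R ∈ ℝ with R ≠ 0 and R ∉ {v_1,…,v_n}, and suppose E[e^{R X}] < ∞. Then E[f(X)] = (1/π) ∫_0^∞ Re( E[e^{(iu+R)X}] · f̂(u − iR) ) du. -/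
open MeasureTheory

/-- The two-sided Laplace transform at `w` of `x ↦ (∑ k, C k * exp (v k * x)) * 1_{(a, b)} x`, in
the form obtained by one integration by parts when the exponential sum vanishes at `a` and `b`. -/
noncomputable def expSumTransform {ι : Type*} [Fintype ι] (C v : ι → ℝ) (a b : ℝ) (w : ℂ) : ℂ :=
  (1 / w) * ∑ k, ((C k : ℂ) * (v k : ℂ) / ((v k : ℂ) - w)) *
    (Complex.exp (((v k : ℂ) - w) * (b : ℂ)) - Complex.exp (((v k : ℂ) - w) * (a : ℂ)))

section ExpSum

variable {ι : Type*} [Fintype ι] {C v : ι → ℝ} {a b R : ℝ}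

lemma I_mul_add_ne_ofReal {R r : ℝ} (h : R ≠ r) (u : ℝ) :
    Complex.I * (u : ℂ) + (R : ℂ) ≠ (r : ℂ) := fun H => h (by
  simpa using congrArg Complex.re H)

lemma expSumTransform_conj (w : ℂ) :
    expSumTransform C v a b ((starRingEnd ℂ) w) = (starRingEnd ℂ) (expSumTransform C v a b w) := by
  simp [expSumTransform, map_sum, ← Complex.exp_conj]

lemma expSumTransform_eq_sum (ha : ∑ k, C k * Real.exp (v k * a) = 0)
    (hb : ∑ k, C k * Real.exp (v k * b) = 0) {w : ℂ} (hw : w ≠ 0) (hwv : ∀ k, w ≠ v k) :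
    expSumTransform C v a b w = ∑ k, (C k : ℂ) *
      ((Complex.exp (((v k : ℂ) - w) * b) - Complex.exp (((v k : ℂ) - w) * a)) /
        ((v k : ℂ) - w)) := by
  have key : ∀ c : ℝ, ∑ k, C k * Real.exp (v k * c) = 0 →
      ∑ k, (C k : ℂ) * Complex.exp (((v k : ℂ) - w) * c) = 0 := by
    intro c hc
    have h : ∑ k, (C k : ℂ) * Complex.exp (v k * c) = 0 := by
      exact_mod_cast congrArg Complex.ofReal hc
    calc ∑ k, (C k : ℂ) * Complex.exp (((v k : ℂ) - w) * c)
        = ∑ k, (C k : ℂ) * Complex.exp (v k * c) * Complex.exp (-w * c) := by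
          refine Finset.sum_congr rfl fun k _ => ?_
          rw [mul_assoc, ← Complex.exp_add]; ring_nf
      _ = 0 := by rw [← Finset.sum_mul, h, zero_mul]
  have h0 : ∑ k, (C k : ℂ) * (Complex.exp (((v k : ℂ) - w) * b) -
      Complex.exp (((v k : ℂ) - w) * a)) = 0 := by
    simp only [mul_sub, Finset.sum_sub_distrib] at key ⊢
    rw [key a ha, key b hb, sub_zero]
  rw [expSumTransform, ← sub_eq_zero, Finset.mul_sum, ← Finset.sum_sub_distrib,
    ← mul_zero (1 / w), ← h0, Finset.mul_sum]
  refine Finset.sum_congr rfl fun k _ => ?_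
  have : (v k : ℂ) - w ≠ 0 := sub_ne_zero.2 (hwv k).symm
  field_simp

lemma continuous_indicator_expSum (hab : a < b) (ha : ∑ k, C k * Real.exp (v k * a) = 0)
    (hb : ∑ k, C k * Real.exp (v k * b) = 0) :
    Continuous ((Set.Ioo a b).indicator fun y => ∑ k, C k * Real.exp (v k * y)) := by
  refine continuous_indicator ?_ (by fun_prop)
  rw [frontier_Ioo hab]
  rintro x (rfl | rfl) <;> assumption

lemma integral_indicator_expSum (hab : a < b) {w : ℂ} (hwv : ∀ k, w ≠ v k) :
    ∫ x : ℝ, Complex.exp (-w * x) *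
        (((Set.Ioo a b).indicator (fun y => ∑ k, C k * Real.exp (v k * y)) x : ℝ) : ℂ) =
      ∑ k, (C k : ℂ) *
        ((Complex.exp (((v k : ℂ) - w) * b) - Complex.exp (((v k : ℂ) - w) * a)) /
          ((v k : ℂ) - w)) := by
  have h1 : ∀ x : ℝ, Complex.exp (-w * x) *
      (((Set.Ioo a b).indicator (fun y => ∑ k, C k * Real.exp (v k * y)) x : ℝ) : ℂ) =
      (Set.Ioo a b).indicator
        (fun y : ℝ => ∑ k, (C k : ℂ) * Complex.exp (((v k : ℂ) - w) * y)) x := by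
    intro x
    by_cases hx : x ∈ Set.Ioo a b
    · simp only [Set.indicator_of_mem hx]
      push_cast
      rw [Finset.mul_sum]
      refine Finset.sum_congr rfl fun k _ => ?_
      rw [mul_left_comm, ← Complex.exp_add]; ring_nf
    · simp [Set.indicator_of_notMem hx]
  simp_rw [h1]
  rw [integral_indicator measurableSet_Ioo, ← integral_Ioc_eq_integral_Ioo,
    ← intervalIntegral.integral_of_le hab.le, intervalIntegral.integral_finsetSum]
  · refine Finset.sum_congr rfl fun k _ => ?_
    rw [intervalIntegral.integral_const_mul, integral_exp_mul_complex (sub_ne_zero.2 (hwv k).symm)]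
  · intro k _
    exact Continuous.intervalIntegrable (by fun_prop) _ _

lemma integrable_inv_sq_add_sq {c : ℝ} (hc : c ≠ 0) :
    Integrable fun u : ℝ => (u ^ 2 + c ^ 2)⁻¹ := by
  refine ((integrable_inv_one_add_sq.comp_div hc).const_mul (c ^ 2)⁻¹).congr (.of_forall fun u => ?_)
  have : u ^ 2 + c ^ 2 ≠ 0 := by positivity
  have : 1 + (u / c) ^ 2 ≠ 0 := by positivity
  simp only
  field_simp
  ring

lemma continuous_expSumTransform_line (hR : R ≠ 0) (hRv : ∀ k, R ≠ v k) :
    Continuous fun u : ℝ => expSumTransform C v a b (Complex.I * u + R) := by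
  unfold expSumTransform
  refine Continuous.mul (continuous_const.div (by fun_prop) fun u => ?_)
    (continuous_finsetSum _ fun k _ =>
      (continuous_const.div (by fun_prop) fun u => ?_).mul (by fun_prop))
  · simpa using I_mul_add_ne_ofReal hR u
  · exact sub_ne_zero.2 (I_mul_add_ne_ofReal (hRv k) u).symm

lemma norm_I_mul_add_sq (u r : ℝ) : ‖Complex.I * (u : ℂ) + (r : ℂ)‖ ^ 2 = u ^ 2 + r ^ 2 := by
  rw [← Complex.normSq_eq_norm_sq, Complex.normSq_apply]
  simp
  ring

lemma integrable_expSumTransform_line (hR : R ≠ 0) (hRv : ∀ k, R ≠ v k) :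
    Integrable fun u : ℝ => expSumTransform C v a b (Complex.I * u + R) := by
  set M : ι → ℝ := fun k => |C k * v k| * (Real.exp ((v k - R) * b) + Real.exp ((v k - R) * a))
  have hdom : Integrable fun u : ℝ =>
      ∑ k, M k * ((u ^ 2 + R ^ 2)⁻¹ + (u ^ 2 + (R - v k) ^ 2)⁻¹) :=
    integrable_finsetSum _ fun k _ => ((integrable_inv_sq_add_sq hR).add
      (integrable_inv_sq_add_sq (sub_ne_zero.2 (hRv k)))).const_mul _
  refine hdom.mono' (continuous_expSumTransform_line hR hRv).aestronglyMeasurable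
    (.of_forall fun u => ?_)
  rw [expSumTransform, Finset.mul_sum]
  refine norm_sum_le_of_le _ fun k _ => ?_
  set w : ℂ := Complex.I * u + R
  have hexp : ∀ c : ℝ, ‖Complex.exp (((v k : ℂ) - w) * c)‖ = Real.exp ((v k - R) * c) := by
    intro c; simp [Complex.norm_exp, w]
  have hE : ‖Complex.exp (((v k : ℂ) - w) * b) - Complex.exp (((v k : ℂ) - w) * a)‖ ≤
      Real.exp ((v k - R) * b) + Real.exp ((v k - R) * a) := by
    rw [← hexp, ← hexp]; exact norm_sub_le _ _
  have h1 : (u ^ 2 + R ^ 2)⁻¹ = ‖w‖⁻¹ ^ 2 := by rw [inv_pow, norm_I_mul_add_sq]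
  have h2 : (u ^ 2 + (R - v k) ^ 2)⁻¹ = ‖(v k : ℂ) - w‖⁻¹ ^ 2 := by
    rw [inv_pow, norm_sub_rev, ← norm_I_mul_add_sq]
    simp only [w]; push_cast; rw [add_sub_assoc]
  rw [h1, h2]
  calc ‖1 / w * ((C k : ℂ) * (v k : ℂ) / ((v k : ℂ) - w) *
        (Complex.exp (((v k : ℂ) - w) * b) - Complex.exp (((v k : ℂ) - w) * a)))‖
      = |C k * v k| * ‖Complex.exp (((v k : ℂ) - w) * b) - Complex.exp (((v k : ℂ) - w) * a)‖ *
        (‖w‖⁻¹ * ‖(v k : ℂ) - w‖⁻¹) := by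
        simp only [norm_mul, norm_div, norm_one, Complex.norm_real, Real.norm_eq_abs, abs_mul]
        ring
    _ ≤ M k * (‖w‖⁻¹ ^ 2 + ‖(v k : ℂ) - w‖⁻¹ ^ 2) := by
        refine mul_le_mul (mul_le_mul_of_nonneg_left hE (abs_nonneg _)) ?_ (by positivity)
          (by positivity)
        nlinarith [sq_nonneg (‖w‖⁻¹ - ‖(v k : ℂ) - w‖⁻¹), sq_nonneg ‖w‖⁻¹,
          sq_nonneg ‖(v k : ℂ) - w‖⁻¹]

open FourierTransform in
/-- Fourier inversion along the line `Re w = R`. -/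
lemma integral_expSumTransform_line (hab : a < b) (ha : ∑ k, C k * Real.exp (v k * a) = 0)
    (hb : ∑ k, C k * Real.exp (v k * b) = 0) (hR : R ≠ 0) (hRv : ∀ k, R ≠ v k) (x : ℝ) :
    ∫ u : ℝ, Complex.exp ((Complex.I * u + R) * x) *
        expSumTransform C v a b (Complex.I * u + R) =
      2 * Real.pi *
        (((Set.Ioo a b).indicator (fun y => ∑ k, C k * Real.exp (v k * y)) x : ℝ) : ℂ) := by
  set p : ℝ → ℝ := (Set.Ioo a b).indicator fun y => ∑ k, C k * Real.exp (v k * y)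
  set g : ℝ → ℂ := fun y => Complex.exp (-R * y) * p y
  have hp : Continuous p := continuous_indicator_expSum hab ha hb
  have hg : Continuous g := by fun_prop
  have hgs : HasCompactSupport g := by
    refine HasCompactSupport.intro (isCompact_Icc (a := a) (b := b)) fun y hy => ?_
    have : p y = 0 := Set.indicator_of_notMem (fun h => hy (Set.Ioo_subset_Icc_self h)) _
    simp [g, this]
  have hF : 𝓕 g = fun ξ : ℝ =>
      expSumTransform C v a b (Complex.I * ((2 * Real.pi * ξ : ℝ) : ℂ) + R) := by
    funext ξ
    have hwv := fun k => I_mul_add_ne_ofReal (hRv k) (2 * Real.pi * ξ)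
    rw [expSumTransform_eq_sum ha hb (by simpa using I_mul_add_ne_ofReal hR (2 * Real.pi * ξ)) hwv,
      ← integral_indicator_expSum hab hwv, Real.fourier_real_eq_integral_exp_smul]
    refine integral_congr_ae (.of_forall fun y => ?_)
    simp only [g, smul_eq_mul]
    rw [← mul_assoc, ← Complex.exp_add]
    congr 2
    push_cast
    ring
  have h2pi : (2 * Real.pi) ≠ 0 := by positivity
  have hFi : Integrable (𝓕 g) := by
    rw [hF]
    exact (integrable_expSumTransform_line hR hRv).comp_mul_left' h2pi
  have hinv := congrFun (hg.fourierInv_fourier_eq (hg.integrable_of_hasCompactSupport hgs) hFi) x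
  rw [Real.fourierInv_eq', hF] at hinv
  have hsub := Measure.integral_comp_mul_left (fun u : ℝ => Complex.exp (Complex.I * u * x) *
        expSumTransform C v a b (Complex.I * u + R)) (2 * Real.pi)
  have hEq : ∫ u : ℝ, Complex.exp (Complex.I * u * x) *
      expSumTransform C v a b (Complex.I * u + R) = 2 * Real.pi * g x := by
    rw [← hinv]
    have : ∀ y : ℝ, Complex.exp (((2 * Real.pi * inner ℝ y x : ℝ) : ℂ) * Complex.I) •
        expSumTransform C v a b (Complex.I * ((2 * Real.pi * y : ℝ) : ℂ) + R) =
        Complex.exp (Complex.I * ((2 * Real.pi * y : ℝ) : ℂ) * x) *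
        expSumTransform C v a b (Complex.I * ((2 * Real.pi * y : ℝ) : ℂ) + R) := by
      intro y
      rw [smul_eq_mul]
      congr 2
      simp
      ring
    simp_rw [this]
    rw [hsub, abs_of_pos (by positivity), Complex.real_smul, Complex.ofReal_inv, Complex.ofReal_mul,
      Complex.ofReal_ofNat, mul_inv_cancel_left₀ (by simp [Real.pi_ne_zero])]
  have hsplit : ∀ u : ℝ, Complex.exp ((Complex.I * u + R) * x) *
      expSumTransform C v a b (Complex.I * u + R) = Complex.exp (R * x) *
      (Complex.exp (Complex.I * u * x) * expSumTransform C v a b (Complex.I * u + R)) := by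
    intro u
    rw [add_mul, Complex.exp_add]; ring
  simp_rw [hsplit]
  rw [integral_const_mul, hEq]
  simp only [g, neg_mul, Complex.exp_neg]
  field_simp [Complex.exp_ne_zero]

lemma norm_exp_I_mul_add_mul (u R x : ℝ) :
    ‖Complex.exp ((Complex.I * u + R) * x)‖ = Real.exp (R * x) := by
  simp [Complex.norm_exp]

lemma integral_Ioi_re_expSumTransform (hab : a < b) (ha : ∑ k, C k * Real.exp (v k * a) = 0)
    (hb : ∑ k, C k * Real.exp (v k * b) = 0) (hR : R ≠ 0) (hRv : ∀ k, R ≠ v k) (x : ℝ) :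
    ∫ u in Set.Ioi (0 : ℝ), (Complex.exp ((Complex.I * u + R) * x) *
        expSumTransform C v a b (Complex.I * u + R)).re =
      Real.pi * (Set.Ioo a b).indicator (fun y => ∑ k, C k * Real.exp (v k * y)) x := by
  set h : ℝ → ℂ := fun u => Complex.exp ((Complex.I * u + R) * x) *
        expSumTransform C v a b (Complex.I * u + R)
  have hi : Integrable h := by
    refine (integrable_expSumTransform_line hR hRv).bdd_mul (c := Real.exp (R * x))
      (Continuous.aestronglyMeasurable (by fun_prop)) (.of_forall fun u => ?_)
    exact (norm_exp_I_mul_add_mul u R x).le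
  have heven : ∀ u, (h (-u)).re = (h u).re := by
    intro u
    have hw : Complex.I * ((-u : ℝ) : ℂ) + R = (starRingEnd ℂ) (Complex.I * u + R) := by simp
    have : h (-u) = (starRingEnd ℂ) (h u) := by
      simp only [h]
      rw [hw, expSumTransform_conj, map_mul, ← Complex.exp_conj, map_mul, Complex.conj_ofReal]
    rw [this, Complex.conj_re]
  have habs : ∀ u, (h |u|).re = (h u).re := fun u => by
    rcases abs_choice u with hu | hu <;> rw [hu]
    exact heven u
  have h2 := integral_comp_abs (f := fun u => (h u).re)
  simp_rw [habs] at h2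
  have h3 : ∫ u, (h u).re = (∫ u, h u).re := integral_re hi
  rw [integral_expSumTransform_line hab ha hb hR hRv x] at h3
  have h4 : (2 * (Real.pi : ℂ) *
      (((Set.Ioo a b).indicator (fun y => ∑ k, C k * Real.exp (v k * y)) x : ℝ) : ℂ)).re =
      2 * Real.pi * (Set.Ioo a b).indicator (fun y => ∑ k, C k * Real.exp (v k * y)) x := by
    norm_cast
  rw [h4] at h3
  change ∫ u in Set.Ioi (0 : ℝ), (h u).re = _
  linarith

end ExpSum

/-- Fourier inversion formula for expectations: with
`f(x) = (Σ C_k e^{v_k x}) 1_{(κ₁,κ₂)}(x)` satisfying the boundary-vanishing conditions,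
`f̂` its explicit Fourier transform, `R ≠ 0`, `R ∉ {v_k}` and `E[e^{RX}] < ∞`,
`E[f(X)] = (1/π) ∫₀^∞ Re( E[e^{(iu+R)X}] f̂(u − iR) ) du`. -/
theorem stmt_12 {Ω : Type*} [MeasurableSpace Ω] (μ : Measure Ω) [IsProbabilityMeasure μ]
    (X : Ω → ℝ) (hX : Measurable X)
    (n : ℕ) (hn : 1 ≤ n) (C v : Fin n → ℝ) (κ₁ κ₂ : ℝ) (hκ : κ₁ < κ₂)
    (f : ℝ → ℝ)
    (hf : ∀ x, f x = Set.indicator (Set.Ioo κ₁ κ₂)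
        (fun y => ∑ k, C k * Real.exp (v k * y)) x)
    (hbd1 : ∑ k, C k * Real.exp (v k * κ₁) = 0)
    (hbd2 : ∑ k, C k * Real.exp (v k * κ₂) = 0)
    (fhat : ℂ → ℂ)
    (hfhat : ∀ z : ℂ, fhat z = (1 / (Complex.I * z)) *
        ∑ k, ((C k : ℂ) * (v k : ℂ) / ((v k : ℂ) - Complex.I * z)) *
          (Complex.exp (((v k : ℂ) - Complex.I * z) * (κ₂ : ℂ))
            - Complex.exp (((v k : ℂ) - Complex.I * z) * (κ₁ : ℂ))))
    (R : ℝ) (hR0 : R ≠ 0) (hRv : ∀ k, R ≠ v k)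
    (hint : Integrable (fun ω => Real.exp (R * X ω)) μ) :
    (∫ ω, f (X ω) ∂μ)
      = (1 / Real.pi) *
        ∫ u in Set.Ioi (0 : ℝ),
          ((∫ ω, Complex.exp ((Complex.I * (u : ℂ) + (R : ℂ)) * (X ω : ℂ)) ∂μ)
            * fhat ((u : ℂ) - Complex.I * (R : ℂ))).re := by
  have hfhat' : ∀ u : ℝ, fhat ((u : ℂ) - Complex.I * (R : ℂ)) =
      expSumTransform C v κ₁ κ₂ (Complex.I * u + R) := by
    intro u
    have : Complex.I * ((u : ℂ) - Complex.I * (R : ℂ)) = Complex.I * u + R := by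
      linear_combination (-(R : ℂ)) * Complex.I_mul_I
    rw [hfhat, this, expSumTransform]
  set F : ℝ → ℂ := fun u => expSumTransform C v κ₁ κ₂ (Complex.I * u + R)
  have hFi : Integrable F := integrable_expSumTransform_line hR0 hRv
  have hprod : Integrable (fun q : Ω × ℝ =>
      Complex.exp ((Complex.I * (q.2 : ℂ) + (R : ℂ)) * (X q.1 : ℂ)) * F q.2)
      (μ.prod (volume.restrict (Set.Ioi 0))) := by
    refine (hint.mul_prod hFi.norm.restrict).mono' ?_ (.of_forall fun q => ?_)
    · exact (Measurable.aestronglyMeasurable (by fun_prop)).mul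
        (hFi.aestronglyMeasurable.restrict.comp_snd)
    · rw [norm_mul, norm_exp_I_mul_add_mul]
  have hpt : ∀ ω, f (X ω) = (1 / Real.pi) * ∫ u in Set.Ioi (0 : ℝ),
      (Complex.exp ((Complex.I * (u : ℂ) + (R : ℂ)) * (X ω : ℂ)) * F u).re := by
    intro ω
    rw [integral_Ioi_re_expSumTransform hκ hbd1 hbd2 hR0 hRv, hf]
    field_simp
  simp_rw [hpt, hfhat']
  rw [integral_const_mul, integral_integral_swap hprod.re]
  congr 1
  refine integral_congr_ae ?_
  filter_upwards [hprod.prod_left_ae] with u hu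
  rw [← integral_mul_const]
  exact integral_re hu
end

section
/- Let λ ≥ 0, t ≥ 0, α⁺ > 0, α⁻ > 0, β⁺, β⁻ ∈ ℝ, and let u ∈ ℝ with −α⁻ < u < α⁺. Then ∫_{e^{−λt}}^{1} [ (β⁺+β⁻) u² v + (β⁺α⁻ − β⁻α⁺) u ] / ( (α⁺ − u v)(α⁻ + u v) ) dv = ((β⁺+β⁻)/2) · log( (α⁺ − e^{−λt}u)(α⁻ + e^{−λt}u) / ((α⁺ − u)(α⁻ + u)) ) + ((β⁺−β⁻)/2) · log( (α⁺ − e^{−λt}u)(α⁻ + u) / ((α⁺ − u)(α⁻ + e^{−λt}u)) ). -/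
/-- For `0 ≤ v ≤ 1`, the factor `a + u * v` is positive as soon as it is at both endpoints. -/
theorem add_mul_pos_of_mem_unit {a u v : ℝ} (ha : 0 < a) (hu : 0 < a + u)
    (hv0 : 0 ≤ v) (hv1 : v ≤ 1) : 0 < a + u * v := by
  rcases le_or_gt 0 u with h | h
  · positivity
  · nlinarith

/-- An antiderivative of the integrand, by partial fractions. -/
theorem hasDerivAt_neg_log_sub_log {a b p m u v : ℝ} (ha : 0 < a - u * v) (hb : 0 < b + u * v) :
    HasDerivAt (fun v => -(p * Real.log (a - u * v)) - m * Real.log (b + u * v))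
      (((p + m) * u ^ 2 * v + (p * b - m * a) * u) / ((a - u * v) * (b + u * v))) v := by
  have hd : HasDerivAt (fun v => u * v) u v := by
    simpa using (hasDerivAt_id v).const_mul u
  refine ((((hd.const_sub a).log ha.ne').const_mul p).neg.sub
    (((hd.const_add b).log hb.ne').const_mul m)).congr_deriv ?_
  have := ha.ne'
  have := hb.ne'
  field_simp
  ring

/-- The definite integral identity computing `φ_t(u)` for the Double Γ-OU process:
for `λ, t ≥ 0`, `α⁺, α⁻ > 0` and `−α⁻ < u < α⁺`,
`∫_{e^{−λt}}^1 [(β⁺+β⁻)u²v + (β⁺α⁻−β⁻α⁺)u]/((α⁺−uv)(α⁻+uv)) dv` equals the stated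
combination of logarithms. -/
theorem stmt_14 (lam t ap am bp bm u : ℝ)
    (hlam : 0 ≤ lam) (ht : 0 ≤ t) (hap : 0 < ap) (ham : 0 < am)
    (hum : -am < u) (hup : u < ap) :
    (∫ v in Real.exp (-(lam * t))..1,
        ((bp + bm) * u ^ 2 * v + (bp * am - bm * ap) * u) / ((ap - u * v) * (am + u * v)))
      = ((bp + bm) / 2) *
          Real.log ((ap - Real.exp (-(lam * t)) * u) * (am + Real.exp (-(lam * t)) * u)
            / ((ap - u) * (am + u)))
        + ((bp - bm) / 2) *
          Real.log ((ap - Real.exp (-(lam * t)) * u) * (am + u)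
            / ((ap - u) * (am + Real.exp (-(lam * t)) * u))) := by
  set e := Real.exp (-(lam * t))
  have he0 : 0 < e := Real.exp_pos _
  have he1 : e ≤ 1 := Real.exp_le_one_iff.mpr (neg_nonpos.mpr (mul_nonneg hlam ht))
  have hA : ∀ v, 0 ≤ v → v ≤ 1 → 0 < ap - u * v := fun v h0 h1 => by
    have := add_mul_pos_of_mem_unit (u := -u) hap (by linarith) h0 h1
    linarith
  have hB : ∀ v, 0 ≤ v → v ≤ 1 → 0 < am + u * v := fun v h0 h1 =>
    add_mul_pos_of_mem_unit ham (by linarith) h0 h1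
  have hmem : ∀ v ∈ Set.uIcc e 1, 0 < ap - u * v ∧ 0 < am + u * v := fun v hv => by
    rw [Set.uIcc_of_le he1] at hv
    exact ⟨hA v (he0.le.trans hv.1) hv.2, hB v (he0.le.trans hv.1) hv.2⟩
  rw [intervalIntegral.integral_eq_sub_of_hasDerivAt
    (fun v hv => hasDerivAt_neg_log_sub_log (hmem v hv).1 (hmem v hv).2)
    (ContinuousOn.intervalIntegrable (ContinuousOn.div (by fun_prop) (by fun_prop)
      fun v hv => (mul_pos (hmem v hv).1 (hmem v hv).2).ne'))]
  have h1 : ap - e * u ≠ 0 := by rw [mul_comm]; exact (hA e he0.le he1).ne'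
  have h2 : am + e * u ≠ 0 := by rw [mul_comm]; exact (hB e he0.le he1).ne'
  have h3 : ap - u ≠ 0 := (sub_pos.mpr hup).ne'
  have h4 : am + u ≠ 0 := (neg_lt_iff_pos_add'.mp hum).ne'
  rw [Real.log_div (mul_ne_zero h1 h2) (mul_ne_zero h3 h4),
    Real.log_div (mul_ne_zero h1 h4) (mul_ne_zero h3 h2), Real.log_mul h1 h2,
    Real.log_mul h3 h4, Real.log_mul h1 h4, Real.log_mul h3 h2, mul_one, mul_comm u e]
  ring
end

section
/- Let X be a real random variable on a probability space with P(X ≠ 0) > 0, and let ū > 0 satisfy E[cosh(ū X)] < ∞. Define m : [0, ū] → ℝ by m(u) = E[cosh(u X)]. Then m is continuous and strictly increasing on [0, ū] with m(0) = 1. Consequently, for every N ∈ ℕ and all reals c_1, …, c_N with 1 ≤ c_N ≤ c_{N−1} ≤ … ≤ c_1 ≤ m(ū), there exists a unique sequence ū ≥ u_1 ≥ u_2 ≥ … ≥ u_N ≥ 0 with m(u_k) = c_k for each k; if the c_k are strictly decreasing then the u_k are strictly decreasing. -/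
open MeasureTheory

theorem cosh_mul_le_cosh_mul {a b : ℝ} (x : ℝ) (ha : 0 ≤ a) (hab : a ≤ b) :
    Real.cosh (a * x) ≤ Real.cosh (b * x) := by
  rw [Real.cosh_le_cosh, abs_mul, abs_mul, abs_of_nonneg ha, abs_of_nonneg (ha.trans hab)]
  exact mul_le_mul_of_nonneg_right hab (abs_nonneg x)

theorem cosh_mul_lt_cosh_mul {a b x : ℝ} (hx : x ≠ 0) (ha : 0 ≤ a) (hab : a < b) :
    Real.cosh (a * x) < Real.cosh (b * x) := by
  rw [Real.cosh_lt_cosh, abs_mul, abs_mul, abs_of_nonneg ha, abs_of_nonneg (ha.trans hab.le)]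
  exact mul_lt_mul_of_pos_right hab (abs_pos.mpr hx)

section CoshMoment

variable {Ω : Type*} [MeasurableSpace Ω] {μ : Measure Ω} {X : Ω → ℝ} {ubar : ℝ}

theorem integrable_cosh_mul_of_le (hX : Measurable X)
    (hint : Integrable (fun ω => Real.cosh (ubar * X ω)) μ) {u : ℝ} (hu : u ∈ Set.Icc 0 ubar) :
    Integrable (fun ω => Real.cosh (u * X ω)) μ := by
  refine hint.mono' (by fun_prop) (Filter.Eventually.of_forall fun ω => ?_)
  rw [Real.norm_of_nonneg (Real.cosh_pos _).le]
  exact cosh_mul_le_cosh_mul _ hu.1 hu.2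

theorem continuousOn_integral_cosh_mul (hX : Measurable X)
    (hint : Integrable (fun ω => Real.cosh (ubar * X ω)) μ) :
    ContinuousOn (fun u => ∫ ω, Real.cosh (u * X ω) ∂μ) (Set.Icc 0 ubar) := by
  refine continuousOn_of_dominated
    (fun u hu => (integrable_cosh_mul_of_le hX hint hu).aestronglyMeasurable)
    (fun u hu => Filter.Eventually.of_forall fun ω => ?_) hint
    (Filter.Eventually.of_forall fun ω => Continuous.continuousOn (by fun_prop))
  rw [Real.norm_of_nonneg (Real.cosh_pos _).le]
  exact cosh_mul_le_cosh_mul _ hu.1 hu.2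

theorem strictMonoOn_integral_cosh_mul (hX : Measurable X) (hne : 0 < μ {ω | X ω ≠ 0})
    (hint : Integrable (fun ω => Real.cosh (ubar * X ω)) μ) :
    StrictMonoOn (fun u => ∫ ω, Real.cosh (u * X ω) ∂μ) (Set.Icc 0 ubar) := by
  intro a ha b hb hab
  have hia := integrable_cosh_mul_of_le hX hint ha
  have hib := integrable_cosh_mul_of_le hX hint hb
  have hpos : 0 < ∫ ω, (Real.cosh (b * X ω) - Real.cosh (a * X ω)) ∂μ := by
    rw [integral_pos_iff_support_of_nonneg
      (fun ω => sub_nonneg.mpr (cosh_mul_le_cosh_mul _ ha.1 hab.le)) (hib.sub hia)]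
    exact hne.trans_le (measure_mono fun ω hω =>
      (sub_pos.mpr (cosh_mul_lt_cosh_mul hω ha.1 hab)).ne')
  rw [integral_sub hib hia] at hpos
  exact sub_pos.mp hpos

end CoshMoment

/-- If `P(X ≠ 0) > 0` and `E[cosh(ū X)] < ∞` for some `ū > 0`, then `m(u) = E[cosh(uX)]` is
continuous and strictly increasing on `[0, ū]` with `m(0) = 1`; consequently any nonincreasing
sequence `c_1 ≥ … ≥ c_N` in `[1, m(ū)]` is matched by a unique nonincreasing sequence
`ū ≥ u_1 ≥ … ≥ u_N ≥ 0` with `m(u_k) = c_k`, strictly decreasing whenever the `c_k` are. -/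
theorem stmt_18 {Ω : Type*} [MeasurableSpace Ω] (μ : Measure Ω) [IsProbabilityMeasure μ]
    (X : Ω → ℝ) (hX : Measurable X)
    (hne : 0 < μ {ω | X ω ≠ 0})
    (ubar : ℝ) (hubar : 0 < ubar)
    (hint : Integrable (fun ω => Real.cosh (ubar * X ω)) μ)
    (m : ℝ → ℝ) (hm : ∀ u, m u = ∫ ω, Real.cosh (u * X ω) ∂μ) :
    ContinuousOn m (Set.Icc 0 ubar) ∧
    StrictMonoOn m (Set.Icc 0 ubar) ∧
    m 0 = 1 ∧
    ∀ (N : ℕ) (c : Fin N → ℝ),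
      (∀ k, 1 ≤ c k) → (∀ j k : Fin N, j ≤ k → c k ≤ c j) → (∀ k, c k ≤ m ubar) →
      ∃ u : Fin N → ℝ,
        (∀ k, u k ∈ Set.Icc 0 ubar) ∧
        (∀ j k : Fin N, j ≤ k → u k ≤ u j) ∧
        (∀ k, m (u k) = c k) ∧
        (∀ u' : Fin N → ℝ,
          (∀ k, u' k ∈ Set.Icc 0 ubar) → (∀ j k : Fin N, j ≤ k → u' k ≤ u' j) →
          (∀ k, m (u' k) = c k) → u' = u) ∧
        ((∀ j k : Fin N, j < k → c k < c j) → ∀ j k : Fin N, j < k → u k < u j) := by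
  obtain rfl : m = fun u => ∫ ω, Real.cosh (u * X ω) ∂μ := funext hm
  have hcont := continuousOn_integral_cosh_mul hX hint
  have hmono := strictMonoOn_integral_cosh_mul hX hne hint
  have hzero : ∫ ω, Real.cosh (0 * X ω) ∂μ = 1 := by simp
  refine ⟨hcont, hmono, hzero, fun N c hc1 hc hcm => ?_⟩
  have hex : ∀ k, ∃ u ∈ Set.Icc 0 ubar, ∫ ω, Real.cosh (u * X ω) ∂μ = c k := fun k =>
    intermediate_value_Icc hubar.le hcont ⟨hzero.le.trans (hc1 k), hcm k⟩
  choose u hu huc using hex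
  refine ⟨u, hu, fun j k hjk => ?_, huc, fun u' hu' _ huc' => ?_, fun hlt j k hjk => ?_⟩
  · rw [← hmono.le_iff_le (hu k) (hu j)]
    simpa only [huc] using hc j k hjk
  · exact funext fun k => hmono.injOn (hu' k) (hu k) ((huc' k).trans (huc k).symm)
  · rw [← hmono.lt_iff_lt (hu k) (hu j)]
    simpa only [huc] using hlt j k hjk
end
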